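/- Let h : ℝ^d → ℝ be smooth and compactly supported, let p ≥ 0, and let [h]_{α,p} be a common α-Hölder constant for all partial derivatives of order p of h, where α ∈ (0,1]. Let f_h(x) = −∫₀¹ (1/(2t)) E[ h̄(√t x + √(1−t) Z) ] dt with h̄ = h − E h(Z), Z ~ N(0, I_d). Then for all indices (i₁,…,i_{p+2}) ∈ {1,…,d}^{p+2} and all x, y ∈ ℝ^d: if |x−y| ≤ 1 then |∂^{p+2}f_h/(∂x_{i₁}…∂x_{i_{p+2}})(x) − ∂^{p+2}f_h/(∂x_{i₁}…∂x_{i_{p+2}})(y)| ≤ [h]_{α,p} |x−y|^α (A − 2 log|x−y|), and if |x−y| > 1 this difference is at most A [h]_{α,p}, where A = 2^{α/2+1} ((α+d+1)/α) Γ((α+d)/2)/Γ(d/2). -/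

import Mathlib

open MeasureTheory ProbabilityTheory Real Filter Set

noncomputable section

/-- The standard Gaussian measure `N(0, I_d)` on `ℝ^d` (as `EuclideanSpace ℝ (Fin d)`). -/
def stdGaussian (d : ℕ) : Measure (EuclideanSpace ℝ (Fin d)) :=
  (Measure.pi fun _ : Fin d => gaussianReal 0 1).map
    ⇑(EuclideanSpace.equiv (Fin d) ℝ).symm

/-- Partial derivative in the `j`-th coordinate direction. -/
def pderivI {d : ℕ} (j : Fin d) (f : EuclideanSpace ℝ (Fin d) → ℝ) :
    EuclideanSpace ℝ (Fin d) → ℝ :=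
  fun x => fderiv ℝ f x (EuclideanSpace.single j 1)

/-- Iterated partial derivative along a list of coordinate directions (head applied last,
i.e. outermost). -/
def pderivList {d : ℕ} : List (Fin d) → (EuclideanSpace ℝ (Fin d) → ℝ) →
    EuclideanSpace ℝ (Fin d) → ℝ
  | [], f => f
  | j :: l, f => pderivI j (pderivList l f)

/-- Multi-index partial derivative `∂^{|m|}/(∂x₁^{m₁} ⋯ ∂x_d^{m_d})`. -/
def pderivMulti {d : ℕ} (m : Fin d → ℕ) (f : EuclideanSpace ℝ (Fin d) → ℝ) :
    EuclideanSpace ℝ (Fin d) → ℝ :=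
  pderivList ((List.finRange d).flatMap fun j => List.replicate (m j) j) f

/-- Multivariate Hermite polynomial
`H_m(x) = (-1)^{|m|} e^{|x|²/2} ∂^{|m|}/(∂x₁^{m₁} ⋯ ∂x_d^{m_d}) e^{-|x|²/2}`. -/
def hermiteMulti {d : ℕ} (m : Fin d → ℕ) (x : EuclideanSpace ℝ (Fin d)) : ℝ :=
  (-1 : ℝ) ^ (∑ j, m j) * Real.exp (‖x‖ ^ 2 / 2) *
    pderivMulti m (fun y => Real.exp (-‖y‖ ^ 2 / 2)) x

/-- `h̄ = h - E h(Z)` with `Z ~ N(0, I_d)`. -/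
def hbar (d : ℕ) (h : EuclideanSpace ℝ (Fin d) → ℝ) (x : EuclideanSpace ℝ (Fin d)) : ℝ :=
  h x - ∫ z, h z ∂(stdGaussian d)

/-- Barbour's solution `f_h(x) = -∫₀¹ (1/(2t)) E[ h̄(√t x + √(1-t) Z) ] dt` of the
multivariate Stein equation. -/
def steinSol (d : ℕ) (h : EuclideanSpace ℝ (Fin d) → ℝ) (x : EuclideanSpace ℝ (Fin d)) : ℝ :=
  -∫ t in Ioo (0 : ℝ) 1,
      (1 / (2 * t)) *
        ∫ z, hbar d h (Real.sqrt t • x + Real.sqrt (1 - t) • z) ∂(stdGaussian d)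

/-- Entry `(i, j)` of the Hessian matrix of `f` at `x`. -/
def hessEntry {d : ℕ} (f : EuclideanSpace ℝ (Fin d) → ℝ) (x : EuclideanSpace ℝ (Fin d))
    (i j : Fin d) : ℝ :=
  pderivI i (pderivI j f) x

/-- The Hessian matrix `∇² f(x)`. -/
def hessMatrix {d : ℕ} (f : EuclideanSpace ℝ (Fin d) → ℝ) (x : EuclideanSpace ℝ (Fin d)) :
    Matrix (Fin d) (Fin d) ℝ :=
  Matrix.of fun i j => hessEntry f x i j

/-- Operator norm `‖M‖_op = sup_{|v| = 1} |M v|` (Euclidean norms) of a `d × d` matrix. -/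
def matOpNorm {d : ℕ} (M : Matrix (Fin d) (Fin d) ℝ) : ℝ :=
  sSup { r | ∃ v : EuclideanSpace ℝ (Fin d), ‖v‖ = 1 ∧
    r = ‖(WithLp.equiv 2 (Fin d → ℝ)).symm (M.mulVec ((WithLp.equiv 2 (Fin d → ℝ)) v))‖ }

/-- The Laplacian `Δ f(x) = ∑ i ∂²f/∂x_i²(x)`. -/
def laplacian {d : ℕ} (f : EuclideanSpace ℝ (Fin d) → ℝ) (x : EuclideanSpace ℝ (Fin d)) : ℝ :=
  ∑ i, hessEntry f x i i

/-- `C` is an `α`-Hölder constant for `h`. -/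
def HolderConst {d : ℕ} (α C : ℝ) (h : EuclideanSpace ℝ (Fin d) → ℝ) : Prop :=
  ∀ x y, |h x - h y| ≤ C * dist x y ^ α

/-- The 1-Wasserstein distance in dual form: sup over 1-Lipschitz test functions. -/
def wasserstein1 {d : ℕ} (μ ν : Measure (EuclideanSpace ℝ (Fin d))) : ℝ :=
  sSup { r | ∃ h : EuclideanSpace ℝ (Fin d) → ℝ, LipschitzWith 1 h ∧
    r = (∫ x, h x ∂μ) - ∫ x, h x ∂ν }

/-- The `α`-Wasserstein distance: sup over continuous `h` with `[h]_α ≤ 1`. -/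
def wassersteinHolder {d : ℕ} (α : ℝ) (μ ν : Measure (EuclideanSpace ℝ (Fin d))) : ℝ :=
  sSup { r | ∃ h : EuclideanSpace ℝ (Fin d) → ℝ, Continuous h ∧ HolderConst α 1 h ∧
    r = (∫ x, h x ∂μ) - ∫ x, h x ∂ν }

/-- The constant `C₁(α, d)`. -/
def C1 (α : ℝ) (d : ℕ) : ℝ :=
  2 ^ (α / 2 + 1) * ((α + 2 * d) / (α * d)) * Real.Gamma ((α + d) / 2) / Real.Gamma (d / 2)

/-- The constant `C₂(α, d)`. -/
def C2 (α : ℝ) (d : ℕ) : ℝ :=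
  if α = 1 then 2 * Real.sqrt (2 / π) * Real.sqrt d
  else 2 ^ (α / 2 + 1) * (α + 2 * d) * Real.Gamma ((α + d) / 2) / (α * Real.Gamma (d / 2))

end

instance stdGaussian.instIsProbabilityMeasure (d : ℕ) : IsProbabilityMeasure (stdGaussian d) :=
  Measure.isProbabilityMeasure_map (by fun_prop)

theorem stdGaussian_eq_probabilityTheory (d : ℕ) :
    stdGaussian d = ProbabilityTheory.stdGaussian (EuclideanSpace ℝ (Fin d)) :=
  map_pi_eq_stdGaussian

/-- The normalising constant of the standard Gaussian density on `ℝ^d`. -/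
noncomputable def gaussianNorm (d : ℕ) : ℝ :=
  (∫ v : EuclideanSpace ℝ (Fin d), Real.exp (-(1 / 2) * ‖v‖ ^ 2))⁻¹

theorem gaussianNorm_eq (d : ℕ) : gaussianNorm d = ((2 * π) ^ ((d : ℝ) / 2))⁻¹ := by
  rw [gaussianNorm, GaussianFourier.integral_rexp_neg_mul_sq_norm (by norm_num)]
  simp [mul_comm]

theorem gaussianNorm_pos (d : ℕ) : 0 < gaussianNorm d := by
  rw [gaussianNorm_eq]; positivity

theorem stdGaussian_eq_withDensity (d : ℕ) :
    stdGaussian d = (volume : Measure (EuclideanSpace ℝ (Fin d))).withDensity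
      fun x => ((gaussianNorm d * Real.exp (-(1 / 2) * ‖x‖ ^ 2)).toNNReal : ENNReal) := by
  have hint : Integrable fun x : EuclideanSpace ℝ (Fin d) =>
      gaussianNorm d * Real.exp (-(1 / 2) * ‖x‖ ^ 2) := by
    refine Integrable.const_mul (Integrable.of_integral_ne_zero ?_) _
    rw [GaussianFourier.integral_rexp_neg_mul_sq_norm (by norm_num)]
    positivity
  have hfin : IsFiniteMeasure ((volume : Measure (EuclideanSpace ℝ (Fin d))).withDensity
      fun x => ((gaussianNorm d * Real.exp (-(1 / 2) * ‖x‖ ^ 2)).toNNReal : ENNReal)) :=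
    isFiniteMeasure_withDensity_ofReal hint.2
  refine Measure.ext_of_charFun ?_
  ext t
  rw [stdGaussian_eq_probabilityTheory, charFun_stdGaussian, charFun_apply,
    integral_withDensity_eq_integral_smul (by fun_prop)]
  have key := GaussianFourier.integral_cexp_neg_mul_sq_norm_add (V := EuclideanSpace ℝ (Fin d))
    (b := 1 / 2) (by norm_num) Complex.I t
  have hpt : ∀ x : EuclideanSpace ℝ (Fin d),
      (gaussianNorm d * Real.exp (-(1 / 2) * ‖x‖ ^ 2)).toNNReal •
        Complex.exp ((inner ℝ x t : ℝ) * Complex.I) =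
      (gaussianNorm d : ℂ) * Complex.exp (-(1 / 2) * ‖x‖ ^ 2 + Complex.I * (inner ℝ t x : ℝ)) := by
    intro x
    rw [NNReal.smul_def, Real.coe_toNNReal _ (mul_nonneg (gaussianNorm_pos d).le (Real.exp_pos _).le),
      Complex.exp_add, real_inner_comm, Complex.real_smul]
    push_cast
    ring_nf
  simp_rw [hpt]
  rw [integral_const_mul, key, gaussianNorm_eq]
  have h2 : ((π : ℂ) / (1 / 2)) ^ ((Module.finrank ℝ (EuclideanSpace ℝ (Fin d)) : ℂ) / 2) =
      (((2 * π) ^ ((d : ℝ) / 2) : ℝ) : ℂ) := by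
    rw [Complex.ofReal_cpow (by positivity)]
    push_cast
    simp [mul_comm]
  rw [h2, ← mul_assoc, ← Complex.ofReal_mul, inv_mul_cancel₀ (by positivity)]
  simp
  ring_nf

theorem integral_stdGaussian_eq (d : ℕ) (f : EuclideanSpace ℝ (Fin d) → ℝ) :
    ∫ x, f x ∂(stdGaussian d) =
      gaussianNorm d * ∫ x, Real.exp (-(1 / 2) * ‖x‖ ^ 2) * f x := by
  rw [stdGaussian_eq_withDensity, integral_withDensity_eq_integral_smul (by fun_prop),
    ← integral_const_mul]
  refine integral_congr_ae (.of_forall fun x => ?_)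
  simp only [NNReal.smul_def, smul_eq_mul]
  rw [Real.coe_toNNReal _ (mul_nonneg (gaussianNorm_pos d).le (Real.exp_pos _).le), mul_assoc]

/-- The absolute moments of the standard Gaussian measure. -/
theorem integral_norm_rpow_stdGaussian {d : ℕ} (hd : 1 ≤ d) {s : ℝ} (hs : 0 ≤ s) :
    ∫ z, ‖z‖ ^ s ∂(stdGaussian d) =
      2 ^ (s / 2) * Real.Gamma ((s + d) / 2) / Real.Gamma (d / 2) := by
  have hd' : (1 : ℝ) ≤ d := by exact_mod_cast hd
  have : Nontrivial (EuclideanSpace ℝ (Fin d)) := by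
    have : Nonempty (Fin d) := ⟨⟨0, hd⟩⟩
    infer_instance
  have radial : ∀ u : ℝ, 0 ≤ u → ∫ x : EuclideanSpace ℝ (Fin d),
      Real.exp (-(1 / 2) * ‖x‖ ^ 2) * ‖x‖ ^ u = (d : ℝ) *
        (volume : Measure (EuclideanSpace ℝ (Fin d))).real (Metric.ball 0 1) *
          ((1 / 2) ^ (-(d + u) / 2) * (1 / 2) * Real.Gamma ((u + d) / 2)) := by
    intro u hu
    rw [integral_fun_norm_addHaar volume (fun r => Real.exp (-(1 / 2) * r ^ 2) * r ^ u)]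
    have e : ∫ y in Ioi (0 : ℝ), y ^ (Module.finrank ℝ (EuclideanSpace ℝ (Fin d)) - 1) •
        (Real.exp (-(1 / 2) * y ^ 2) * y ^ u) =
        ∫ y in Ioi (0 : ℝ), y ^ ((d : ℝ) - 1 + u) * Real.exp (-(1 / 2) * y ^ (2 : ℝ)) := by
      refine setIntegral_congr_fun measurableSet_Ioi fun y hy => ?_
      have hy : 0 < y := hy
      simp only [finrank_euclideanSpace, Fintype.card_fin, smul_eq_mul, Real.rpow_two]
      rw [Real.rpow_add hy, ← Nat.cast_pred (by lia), Real.rpow_natCast]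
      ring
    rw [e, integral_rpow_mul_exp_neg_mul_rpow (by norm_num) (by linarith) (by norm_num)]
    simp only [finrank_euclideanSpace, Fintype.card_fin, smul_eq_mul, nsmul_eq_mul]
    ring_nf
  have one := integral_stdGaussian_eq d fun z => ‖z‖ ^ (0 : ℝ)
  rw [radial 0 le_rfl] at one
  simp only [Real.rpow_zero, integral_const, probReal_univ, smul_eq_mul, mul_one] at one
  rw [integral_stdGaussian_eq, radial s hs]
  have hG : 0 < Real.Gamma (d / 2) := Real.Gamma_pos_of_pos (by positivity)
  rw [eq_div_iff hG.ne', show -((d : ℝ) + s) / 2 = -(d + 0) / 2 + (-(s / 2)) by ring,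
    Real.rpow_add (by norm_num), Real.rpow_neg (by norm_num) (s / 2), one_div,
    Real.inv_rpow (by norm_num) (s / 2), inv_inv]
  rw [zero_add] at one
  rw [one_div] at one
  linear_combination (-(2 : ℝ) ^ (s / 2) * Real.Gamma ((s + d) / 2)) * one

theorem integrable_norm_rpow_stdGaussian {d : ℕ} (hd : 1 ≤ d) {s : ℝ} (hs : 0 ≤ s) :
    Integrable (fun z => ‖z‖ ^ s) (stdGaussian d) := by
  have hd' : (1 : ℝ) ≤ d := by exact_mod_cast hd
  refine Integrable.of_integral_ne_zero ?_
  rw [integral_norm_rpow_stdGaussian hd hs]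
  have := Real.Gamma_pos_of_pos (s := (d : ℝ) / 2) (by positivity)
  have := Real.Gamma_pos_of_pos (s := (s + d : ℝ) / 2) (by positivity)
  positivity

theorem ContDiff.pderivI {d : ℕ} {g : EuclideanSpace ℝ (Fin d) → ℝ}
    (hg : ContDiff ℝ (⊤ : ℕ∞) g) (i : Fin d) : ContDiff ℝ (⊤ : ℕ∞) (pderivI i g) :=
  (hg.fderiv_right (m := (⊤ : ℕ∞)) (by simp)).clm_apply contDiff_const

theorem HasCompactSupport.pderivI {d : ℕ} {g : EuclideanSpace ℝ (Fin d) → ℝ}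
    (hg : HasCompactSupport g) (i : Fin d) : HasCompactSupport (pderivI i g) :=
  hg.fderiv_apply ℝ _

theorem ContDiff.pderivList {d : ℕ} {g : EuclideanSpace ℝ (Fin d) → ℝ}
    (hg : ContDiff ℝ (⊤ : ℕ∞) g) (l : List (Fin d)) : ContDiff ℝ (⊤ : ℕ∞) (pderivList l g) := by
  induction l with
  | nil => exact hg
  | cons i l ih => exact ih.pderivI i

theorem HasCompactSupport.pderivList {d : ℕ} {g : EuclideanSpace ℝ (Fin d) → ℝ}
    (hg : HasCompactSupport g) (l : List (Fin d)) : HasCompactSupport (pderivList l g) := by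
  induction l with
  | nil => exact hg
  | cons i l ih => exact ih.pderivI i

theorem pderivI_comp_add_smul {d : ℕ} {g : EuclideanSpace ℝ (Fin d) → ℝ}
    (hg : Differentiable ℝ g) (i : Fin d) (a : EuclideanSpace ℝ (Fin d)) (s : ℝ) :
    pderivI i (fun z => g (a + s • z)) = fun z => s * pderivI i g (a + s • z) := by
  ext z
  have h1 : HasFDerivAt (fun z : EuclideanSpace ℝ (Fin d) => a + s • z)
      (s • ContinuousLinearMap.id ℝ _) z :=
    ((hasFDerivAt_id z).const_smul s).const_add a
  have h2 := (hg (a + s • z)).hasFDerivAt.comp z h1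
  have h3 : fderiv ℝ (fun z => g (a + s • z)) z = _ := h2.fderiv
  simp [pderivI, h3]

theorem HasCompactSupport.comp_add_smul {d : ℕ} {g : EuclideanSpace ℝ (Fin d) → ℝ}
    (hg : HasCompactSupport g) (a : EuclideanSpace ℝ (Fin d)) {s : ℝ} (hs : s ≠ 0) :
    HasCompactSupport fun z => g (a + s • z) :=
  hg.comp_homeomorph ((Homeomorph.smulOfNeZero s hs).trans (Homeomorph.addLeft a))

theorem integrable_stdGaussian_of_continuous_hasCompactSupport {d : ℕ}
    {g : EuclideanSpace ℝ (Fin d) → ℝ} (hc : Continuous g) (hg : HasCompactSupport g) :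
    Integrable g (stdGaussian d) :=
  hc.integrable_of_hasCompactSupport hg

/-- Gaussian integration by parts. -/
theorem integral_pderivI_stdGaussian {d : ℕ} {φ : EuclideanSpace ℝ (Fin d) → ℝ}
    (hφ : ContDiff ℝ (⊤ : ℕ∞) φ) (hsupp : HasCompactSupport φ) (i : Fin d) :
    ∫ z, pderivI i φ z ∂(stdGaussian d) = ∫ z, z i * φ z ∂(stdGaussian d) := by
  have hE : ∀ x : EuclideanSpace ℝ (Fin d),
      HasFDerivAt (fun x : EuclideanSpace ℝ (Fin d) => Real.exp (-(1 / 2) * ‖x‖ ^ 2))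
        (Real.exp (-(1 / 2) * ‖x‖ ^ 2) • (-(1 / 2 : ℝ)) • (2 : ℕ) • innerSL ℝ x) x := fun x =>
    ((hasStrictFDerivAt_norm_sq x).hasFDerivAt.const_mul (-(1 / 2 : ℝ))).exp
  have hv : ∀ x : EuclideanSpace ℝ (Fin d),
      fderiv ℝ (fun x : EuclideanSpace ℝ (Fin d) => Real.exp (-(1 / 2) * ‖x‖ ^ 2)) x
        (EuclideanSpace.single i 1) = -(Real.exp (-(1 / 2) * ‖x‖ ^ 2) * x i) := by
    intro x
    rw [(hE x).fderiv]
    simp [EuclideanSpace.inner_single_right]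
  have hφc := hφ.continuous
  have hφ' := (hφ.pderivI i).continuous
  have key := integral_mul_fderiv_eq_neg_fderiv_mul_of_integrable
    (μ := (volume : Measure (EuclideanSpace ℝ (Fin d)))) (v := EuclideanSpace.single i (1 : ℝ))
    (f := fun x : EuclideanSpace ℝ (Fin d) => Real.exp (-(1 / 2) * ‖x‖ ^ 2)) (g := φ)
    (by
      simp_rw [hv]
      exact Continuous.integrable_of_hasCompactSupport (by fun_prop) (hsupp.mul_left))
    (Continuous.integrable_of_hasCompactSupport
      (Continuous.mul (by fun_prop) hφ') ((hsupp.pderivI i).mul_left))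
    (Continuous.integrable_of_hasCompactSupport (by fun_prop) (hsupp.mul_left))
    (fun x _ => (hE x).differentiableAt) (fun x _ => hφ.differentiable (by simp) x)
  simp_rw [hv] at key
  rw [integral_stdGaussian_eq, integral_stdGaussian_eq]
  congr 1
  refine key.trans ?_
  rw [← integral_neg]
  congr 1 with x
  ring

/-- The second order Hermite polynomial `z_i z_j - δ_{ij}`. -/
def hermiteTwo {d : ℕ} (i j : Fin d) (z : EuclideanSpace ℝ (Fin d)) : ℝ :=
  z i * z j - if i = j then 1 else 0

@[fun_prop]
theorem continuous_hermiteTwo {d : ℕ} (i j : Fin d) : Continuous (hermiteTwo i j) := by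
  unfold hermiteTwo
  fun_prop

theorem abs_hermiteTwo_le {d : ℕ} (i j : Fin d) (z : EuclideanSpace ℝ (Fin d)) :
    |hermiteTwo i j z| ≤ ‖z‖ ^ 2 + 1 := by
  have hi : |z i| ≤ ‖z‖ := PiLp.norm_apply_le z i
  have hj : |z j| ≤ ‖z‖ := PiLp.norm_apply_le z j
  refine (abs_sub _ _).trans (add_le_add ?_ ?_)
  · rw [abs_mul, sq]
    gcongr
  · split_ifs <;> simp

theorem integral_pderivI_pderivI_stdGaussian {d : ℕ} {g : EuclideanSpace ℝ (Fin d) → ℝ}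
    (hg : ContDiff ℝ (⊤ : ℕ∞) g) (hsupp : HasCompactSupport g) (i j : Fin d)
    (a : EuclideanSpace ℝ (Fin d)) {s : ℝ} (hs : s ≠ 0) :
    s ^ 2 * ∫ z, pderivI i (pderivI j g) (a + s • z) ∂(stdGaussian d) =
      ∫ z, hermiteTwo i j z * g (a + s • z) ∂(stdGaussian d) := by
  have haff : ContDiff ℝ (⊤ : ℕ∞) fun z : EuclideanSpace ℝ (Fin d) => a + s • z := by fun_prop
  have hproj : ContDiff ℝ (⊤ : ℕ∞) fun z : EuclideanSpace ℝ (Fin d) => z i := by fun_prop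
  have hgz : ContDiff ℝ (⊤ : ℕ∞) fun z => g (a + s • z) := hg.comp haff
  have hgj : ContDiff ℝ (⊤ : ℕ∞) fun z => pderivI j g (a + s • z) := (hg.pderivI j).comp haff
  have c0 := hsupp.comp_add_smul a hs
  have cj := (hsupp.pderivI j).comp_add_smul a hs
  have e1 := integral_pderivI_stdGaussian hgj cj i
  rw [pderivI_comp_add_smul ((hg.pderivI j).differentiable (by simp))] at e1
  have e2 := integral_pderivI_stdGaussian (hproj.mul hgz) c0.mul_left j
  have hprod : pderivI j (fun z : EuclideanSpace ℝ (Fin d) => z i * g (a + s • z)) = fun z =>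
      s * (z i * pderivI j g (a + s • z)) + (if i = j then 1 else 0) * g (a + s • z) := by
    ext z
    have hd1 : HasFDerivAt (fun z : EuclideanSpace ℝ (Fin d) => z i)
        (EuclideanSpace.proj i : EuclideanSpace ℝ (Fin d) →L[ℝ] ℝ) z :=
      (EuclideanSpace.proj i : EuclideanSpace ℝ (Fin d) →L[ℝ] ℝ).hasFDerivAt
    have hd2 := (hgz.differentiable (by simp) z).hasFDerivAt
    have := congrFun (pderivI_comp_add_smul (hg.differentiable (by simp)) j a s) z
    simp only [pderivI] at this ⊢
    rw [HasFDerivAt.fderiv (hd1.fun_mul hd2)]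
    simp [this]
    ring
  have i1 : Integrable (fun z : EuclideanSpace ℝ (Fin d) => z i * pderivI j g (a + s • z))
      (stdGaussian d) :=
    integrable_stdGaussian_of_continuous_hasCompactSupport
      (hproj.mul hgj).continuous cj.mul_left
  have i0 : Integrable (fun z : EuclideanSpace ℝ (Fin d) => g (a + s • z)) (stdGaussian d) :=
    integrable_stdGaussian_of_continuous_hasCompactSupport hgz.continuous c0
  have i2 : Integrable (fun z : EuclideanSpace ℝ (Fin d) => z j * (z i * g (a + s • z)))
      (stdGaussian d) :=
    integrable_stdGaussian_of_continuous_hasCompactSupport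
      (Continuous.mul (by fun_prop) (hproj.mul hgz).continuous) c0.mul_left.mul_left
  rw [hprod, integral_add (i1.const_mul s) (i0.const_mul _), integral_const_mul,
    integral_const_mul] at e2
  rw [integral_const_mul] at e1
  have e3 : ∫ z, hermiteTwo i j z * g (a + s • z) ∂(stdGaussian d) =
      ∫ z, z j * (z i * g (a + s • z)) ∂(stdGaussian d) -
        (if i = j then 1 else 0) * ∫ z, g (a + s • z) ∂(stdGaussian d) := by
    rw [← integral_const_mul, ← integral_sub i2 (i0.const_mul _)]
    congr 1 with z
    simp only [hermiteTwo]
    ring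
  rw [e3]
  linear_combination s * e1 + e2

theorem memLp_norm_stdGaussian (d : ℕ) : MemLp (fun z => ‖z‖) 2 (stdGaussian d) := by
  rw [stdGaussian_eq_probabilityTheory]
  exact (IsGaussian.memLp_two_id).norm

theorem memLp_apply_stdGaussian {d : ℕ} (i : Fin d) :
    MemLp (fun z : EuclideanSpace ℝ (Fin d) => z i) 2 (stdGaussian d) :=
  (memLp_norm_stdGaussian d).mono (by fun_prop) (.of_forall fun z => by
    simpa using PiLp.norm_apply_le z i)

theorem integrable_norm_sq_stdGaussian (d : ℕ) :
    Integrable (fun z => ‖z‖ ^ 2) (stdGaussian d) :=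
  (memLp_norm_stdGaussian d).integrable_sq

theorem integrable_norm_stdGaussian (d : ℕ) : Integrable (fun z => ‖z‖) (stdGaussian d) :=
  (memLp_norm_stdGaussian d).integrable (by norm_num)

theorem integral_apply_mul_apply_stdGaussian {d : ℕ} (i j : Fin d) :
    ∫ z : EuclideanSpace ℝ (Fin d), z i * z j ∂(stdGaussian d) = if i = j then 1 else 0 := by
  have hcov := congrFun (congrArg DFunLike.coe (congrFun (congrArg DFunLike.coe
    (covarianceBilin_stdGaussian (E := EuclideanSpace ℝ (Fin d))))
      (EuclideanSpace.single i 1))) (EuclideanSpace.single j 1)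
  rw [covarianceBilin_apply_eq_cov IsGaussian.memLp_two_id, covariance_eq_sub] at hcov
  · have mean : ∀ k : Fin d, ∫ z : EuclideanSpace ℝ (Fin d),
        inner ℝ (EuclideanSpace.single k 1) z ∂(ProbabilityTheory.stdGaussian _) = 0 := fun k =>
      integral_strongDual_stdGaussian (innerSL ℝ (EuclideanSpace.single k (1 : ℝ)))
    simp only [mean] at hcov
    rw [innerSL_apply_apply] at hcov
    rw [stdGaussian_eq_probabilityTheory]
    simpa [EuclideanSpace.inner_single_left, Pi.single_apply, eq_comm] using hcov
  all_goals
    simp only [EuclideanSpace.inner_single_left, ← stdGaussian_eq_probabilityTheory, map_one,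
      one_mul]
    exact memLp_apply_stdGaussian _

theorem integrable_hermiteTwo {d : ℕ} (i j : Fin d) :
    Integrable (hermiteTwo i j) (stdGaussian d) :=
  ((integrable_norm_sq_stdGaussian d).add (integrable_const 1)).mono'
    (continuous_hermiteTwo i j).aestronglyMeasurable (.of_forall fun z => abs_hermiteTwo_le i j z)

theorem integral_hermiteTwo {d : ℕ} (i j : Fin d) :
    ∫ z, hermiteTwo i j z ∂(stdGaussian d) = 0 := by
  unfold hermiteTwo
  rw [integral_sub _ (integrable_const _), integral_apply_mul_apply_stdGaussian]
  · simp
  · exact (memLp_apply_stdGaussian i).integrable_mul (memLp_apply_stdGaussian j)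

theorem integral_abs_hermiteTwo_le {d : ℕ} (i j : Fin d) :
    ∫ z, |hermiteTwo i j z| ∂(stdGaussian d) ≤ 2 := by
  have hsq : ∀ k : Fin d, Integrable (fun z : EuclideanSpace ℝ (Fin d) => z k * z k)
      (stdGaussian d) := fun k =>
    (memLp_apply_stdGaussian k).integrable_mul (memLp_apply_stdGaussian k)
  have hsum : Integrable (fun z : EuclideanSpace ℝ (Fin d) => 1 / 2 * (z i * z i + z j * z j))
      (stdGaussian d) := ((hsq i).add (hsq j)).const_mul (1 / 2)
  have hint := hsum.add (integrable_const (1 : ℝ))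
  have hle : ∫ z, |hermiteTwo i j z| ∂(stdGaussian d) ≤
      ∫ z : EuclideanSpace ℝ (Fin d), (1 / 2 * (z i * z i + z j * z j) + 1) ∂(stdGaussian d) := by
    refine integral_mono (integrable_hermiteTwo i j).abs hint fun z => ?_
    refine (abs_sub _ _).trans (add_le_add ?_ ?_)
    · rw [abs_le]
      constructor <;> nlinarith [sq_nonneg (z i - z j), sq_nonneg (z i + z j)]
    · split_ifs <;> simp
  refine hle.trans_eq ?_
  rw [integral_add hsum (integrable_const _), integral_const_mul, integral_add (hsq i) (hsq j)]
  simp only [integral_apply_mul_apply_stdGaussian]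
  norm_num

theorem integral_norm_rpow_mul_stdGaussian {d : ℕ} (hd : 1 ≤ d) {α : ℝ} (hα : 0 < α) :
    ∫ z, ‖z‖ ^ α * (‖z‖ ^ 2 + 1) ∂(stdGaussian d) =
      2 ^ (α / 2) * (α + d + 1) * Real.Gamma ((α + d) / 2) / Real.Gamma (d / 2) := by
  have e : ∀ z : EuclideanSpace ℝ (Fin d), ‖z‖ ^ α * (‖z‖ ^ 2 + 1) = ‖z‖ ^ (α + 2) + ‖z‖ ^ α := by
    intro z
    rw [Real.rpow_add_of_nonneg (norm_nonneg z) hα.le (by norm_num), Real.rpow_two]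
    ring
  simp_rw [e]
  rw [integral_add (integrable_norm_rpow_stdGaussian hd (by linarith))
    (integrable_norm_rpow_stdGaussian hd hα.le), integral_norm_rpow_stdGaussian hd (by linarith),
    integral_norm_rpow_stdGaussian hd hα.le, show (α + 2 + d) / 2 = (α + d) / 2 + 1 by ring,
    Real.Gamma_add_one (by positivity), show (α + 2) / 2 = α / 2 + 1 by ring,
    Real.rpow_add_one (by norm_num)]
  ring

theorem integrable_norm_rpow_mul_stdGaussian {d : ℕ} (hd : 1 ≤ d) {α : ℝ} (hα : 0 < α) :
    Integrable (fun z => ‖z‖ ^ α * (‖z‖ ^ 2 + 1)) (stdGaussian d) := by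
  have hd' : (1 : ℝ) ≤ d := by exact_mod_cast hd
  refine Integrable.of_integral_ne_zero ?_
  rw [integral_norm_rpow_mul_stdGaussian hd hα]
  have := Real.Gamma_pos_of_pos (s := (d : ℝ) / 2) (by positivity)
  have := Real.Gamma_pos_of_pos (s := (α + d : ℝ) / 2) (by positivity)
  positivity

theorem integrable_hermiteTwo_mul {d : ℕ} {g : EuclideanSpace ℝ (Fin d) → ℝ}
    (hg : Continuous g) (hsupp : HasCompactSupport g) (i j : Fin d)
    (a : EuclideanSpace ℝ (Fin d)) {s : ℝ} (hs : s ≠ 0) :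
    Integrable (fun z => hermiteTwo i j z * g (a + s • z)) (stdGaussian d) :=
  integrable_stdGaussian_of_continuous_hasCompactSupport
    ((continuous_hermiteTwo i j).mul (hg.comp (by fun_prop))) (hsupp.comp_add_smul a hs).mul_left

/-- The smoothed second derivatives of an `α`-Hölder function are `α`-Hölder. -/
theorem sq_mul_abs_integral_pderivI_sub_le {d : ℕ} {g : EuclideanSpace ℝ (Fin d) → ℝ}
    (hg : ContDiff ℝ (⊤ : ℕ∞) g) (hsupp : HasCompactSupport g) {α L : ℝ} (hL0 : 0 ≤ L)
    (hL : ∀ x y, |g x - g y| ≤ L * dist x y ^ α) (i j : Fin d)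
    (a b : EuclideanSpace ℝ (Fin d)) {s : ℝ} (hs : 0 < s) :
    s ^ 2 * |∫ z, pderivI i (pderivI j g) (a + s • z) ∂(stdGaussian d) -
      ∫ z, pderivI i (pderivI j g) (b + s • z) ∂(stdGaussian d)| ≤ 2 * L * dist a b ^ α := by
  have hq := integrable_hermiteTwo i j
  calc s ^ 2 * |∫ z, pderivI i (pderivI j g) (a + s • z) ∂(stdGaussian d) -
        ∫ z, pderivI i (pderivI j g) (b + s • z) ∂(stdGaussian d)|
      = |∫ z, (hermiteTwo i j z * g (a + s • z) - hermiteTwo i j z * g (b + s • z))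
          ∂(stdGaussian d)| := by
        rw [integral_sub (integrable_hermiteTwo_mul hg.continuous hsupp i j a hs.ne')
          (integrable_hermiteTwo_mul hg.continuous hsupp i j b hs.ne'),
          ← integral_pderivI_pderivI_stdGaussian hg hsupp i j a hs.ne',
          ← integral_pderivI_pderivI_stdGaussian hg hsupp i j b hs.ne', ← mul_sub, abs_mul,
          abs_of_nonneg (sq_nonneg s)]
    _ ≤ ∫ z, |hermiteTwo i j z| * (L * dist a b ^ α) ∂(stdGaussian d) := by
        rw [← Real.norm_eq_abs]
        refine norm_integral_le_of_norm_le (hq.abs.mul_const _) (.of_forall fun z => ?_)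
        rw [← mul_sub, Real.norm_eq_abs, abs_mul]
        gcongr
        simpa using hL (a + s • z) (b + s • z)
    _ ≤ 2 * (L * dist a b ^ α) := by
        rw [integral_mul_const]
        gcongr
        exact integral_abs_hermiteTwo_le i j
    _ = 2 * L * dist a b ^ α := by ring

/-- The smoothed second derivatives of an `α`-Hölder function blow up at most like the `α - 2`
power of the smoothing scale. -/
theorem sq_mul_abs_integral_pderivI_le {d : ℕ} (hd : 1 ≤ d) {g : EuclideanSpace ℝ (Fin d) → ℝ}
    (hg : ContDiff ℝ (⊤ : ℕ∞) g) (hsupp : HasCompactSupport g) {α L : ℝ} (hα : 0 < α)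
    (hL : ∀ x y, |g x - g y| ≤ L * dist x y ^ α) (i j : Fin d)
    (a : EuclideanSpace ℝ (Fin d)) {s : ℝ} (hs : 0 < s) :
    s ^ 2 * |∫ z, pderivI i (pderivI j g) (a + s • z) ∂(stdGaussian d)| ≤
      L * s ^ α * ∫ z, ‖z‖ ^ α * (‖z‖ ^ 2 + 1) ∂(stdGaussian d) := by
  have hq := integrable_hermiteTwo i j
  calc s ^ 2 * |∫ z, pderivI i (pderivI j g) (a + s • z) ∂(stdGaussian d)|
      = |∫ z, (hermiteTwo i j z * g (a + s • z) - hermiteTwo i j z * g a)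
          ∂(stdGaussian d)| := by
        rw [integral_sub (integrable_hermiteTwo_mul hg.continuous hsupp i j a hs.ne')
          (hq.mul_const _), integral_mul_const, integral_hermiteTwo, zero_mul, sub_zero,
          ← integral_pderivI_pderivI_stdGaussian hg hsupp i j a hs.ne', abs_mul,
          abs_of_nonneg (sq_nonneg s)]
    _ ≤ ∫ z, L * s ^ α * (‖z‖ ^ α * (‖z‖ ^ 2 + 1)) ∂(stdGaussian d) := by
        rw [← Real.norm_eq_abs]
        refine norm_integral_le_of_norm_le
          ((integrable_norm_rpow_mul_stdGaussian hd hα).const_mul _) (.of_forall fun z => ?_)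
        have h1 : |g (a + s • z) - g a| ≤ L * (s ^ α * ‖z‖ ^ α) := by
          refine (hL _ _).trans_eq ?_
          rw [dist_self_add_left, norm_smul, Real.norm_of_nonneg hs.le,
            Real.mul_rpow hs.le (norm_nonneg z)]
        rw [← mul_sub, Real.norm_eq_abs, abs_mul]
        calc |hermiteTwo i j z| * |g (a + s • z) - g a|
            ≤ (‖z‖ ^ 2 + 1) * (L * (s ^ α * ‖z‖ ^ α)) := by
              gcongr
              exact abs_hermiteTwo_le i j z
          _ = L * s ^ α * (‖z‖ ^ α * (‖z‖ ^ 2 + 1)) := by ring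
    _ = L * s ^ α * ∫ z, ‖z‖ ^ α * (‖z‖ ^ 2 + 1) ∂(stdGaussian d) := integral_const_mul _ _

/-- The product of Lebesgue measure on `(0, 1)` with the standard Gaussian measure. -/
noncomputable def timeGaussian (d : ℕ) : Measure (ℝ × EuclideanSpace ℝ (Fin d)) :=
  (volume.restrict (Ioo 0 1)).prod (stdGaussian d)

/-- The Ornstein-Uhlenbeck interpolation `√t x + √(1-t) z`. -/
noncomputable def ouPoint {d : ℕ} (x : EuclideanSpace ℝ (Fin d)) (q : ℝ × EuclideanSpace ℝ (Fin d)) :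
    EuclideanSpace ℝ (Fin d) :=
  Real.sqrt q.1 • x + Real.sqrt (1 - q.1) • q.2

/-- The integrand of the derivatives of order `k` of Barbour's solution. -/
noncomputable def ouIntegrand {d : ℕ} (g c : EuclideanSpace ℝ (Fin d) → ℝ) (k : ℕ)
    (x : EuclideanSpace ℝ (Fin d)) (q : ℝ × EuclideanSpace ℝ (Fin d)) : ℝ :=
  Real.sqrt q.1 ^ k * (1 / (2 * q.1)) * (g (ouPoint x q) - c q.2)

@[fun_prop]
theorem continuous_ouPoint {d : ℕ} (x : EuclideanSpace ℝ (Fin d)) : Continuous (ouPoint x) := by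
  unfold ouPoint
  fun_prop

theorem measurable_ouIntegrand {d : ℕ} {g c : EuclideanSpace ℝ (Fin d) → ℝ} (hg : Continuous g)
    (hc : Continuous c) (k : ℕ) (x : EuclideanSpace ℝ (Fin d)) :
    Measurable (ouIntegrand g c k x) := by
  unfold ouIntegrand
  have : Measurable fun q : ℝ × EuclideanSpace ℝ (Fin d) => g (ouPoint x q) - c q.2 :=
    ((hg.comp (continuous_ouPoint x)).sub (hc.comp continuous_snd)).measurable
  fun_prop

theorem ae_timeGaussian {d : ℕ} : ∀ᵐ q ∂(timeGaussian d), q.1 ∈ Ioo (0 : ℝ) 1 := by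
  have h : ∀ᵐ t ∂(volume.restrict (Ioo (0 : ℝ) 1)), t ∈ Ioo (0 : ℝ) 1 :=
    ae_restrict_mem measurableSet_Ioo
  exact Measure.quasiMeasurePreserving_fst.ae h

theorem sqrt_pow_succ_div_le {t : ℝ} (ht : t ∈ Ioo (0 : ℝ) 1) (k : ℕ) :
    Real.sqrt t ^ (k + 1) * (1 / (2 * t)) ≤ 1 / 2 * t ^ (-(1 / 2) : ℝ) := by
  have h0 := Real.sqrt_pos.2 ht.1
  have h1 : Real.sqrt t ≤ 1 := Real.sqrt_le_one.2 ht.2.le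
  have hp : Real.sqrt t ^ k ≤ 1 := pow_le_one₀ h0.le h1
  rw [Real.rpow_neg ht.1.le, ← Real.sqrt_eq_rpow]
  have e : Real.sqrt t ^ (k + 1) * (1 / (2 * t)) =
      1 / 2 * (Real.sqrt t ^ k * (Real.sqrt t)⁻¹) := by
    nth_rewrite 2 [← Real.sq_sqrt ht.1.le]
    field_simp
    ring
  rw [e]
  gcongr
  exact mul_le_of_le_one_left (by positivity) hp

theorem integrable_timeGaussian_rpow_mul {d : ℕ} {w : EuclideanSpace ℝ (Fin d) → ℝ}
    (hw : Integrable w (stdGaussian d)) :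
    Integrable (fun q => 1 / 2 * q.1 ^ (-(1 / 2) : ℝ) * w q.2) (timeGaussian d) := by
  have := intervalIntegral.intervalIntegrable_rpow' (a := 0) (b := 1) (r := -(1 / 2)) (by norm_num)
  rw [intervalIntegrable_iff_integrableOn_Ioo_of_le zero_le_one] at this
  exact Integrable.mul_prod (Integrable.const_mul this (1 / 2)) hw

theorem integrable_ouIntegrand_zero {d : ℕ} {g : EuclideanSpace ℝ (Fin d) → ℝ}
    (hg : Continuous g) (hsupp : HasCompactSupport g) {k : ℕ} (hk : k ≠ 0)
    (x : EuclideanSpace ℝ (Fin d)) : Integrable (ouIntegrand g 0 k x) (timeGaussian d) := by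
  obtain ⟨C, hC⟩ := hg.bounded_above_of_compact_support hsupp
  obtain ⟨k, rfl⟩ := Nat.exists_eq_succ_of_ne_zero hk
  refine (integrable_timeGaussian_rpow_mul (integrable_const C)).mono'
    (measurable_ouIntegrand hg continuous_zero _ x).aestronglyMeasurable ?_
  filter_upwards [ae_timeGaussian] with q hq
  have h0 : 0 < q.1 := hq.1
  rw [ouIntegrand, Pi.zero_apply, sub_zero, norm_mul, Real.norm_of_nonneg (by positivity)]
  exact mul_le_mul (sqrt_pow_succ_div_le hq k) (hC _) (norm_nonneg _) (by positivity)

theorem integrable_ouIntegrand_self {d : ℕ} {h : EuclideanSpace ℝ (Fin d) → ℝ}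
    (hh : ContDiff ℝ (⊤ : ℕ∞) h) (hsupp : HasCompactSupport h) (x : EuclideanSpace ℝ (Fin d)) :
    Integrable (ouIntegrand h h 0 x) (timeGaussian d) := by
  obtain ⟨C, hC⟩ := (hh.of_le (m := 1) (by simp)).lipschitzWith_of_hasCompactSupport hsupp (by simp)
  refine (integrable_timeGaussian_rpow_mul
    (((integrable_const ‖x‖).add (integrable_norm_stdGaussian d)).const_mul (C : ℝ))).mono'
    (measurable_ouIntegrand hh.continuous hh.continuous _ x).aestronglyMeasurable ?_
  filter_upwards [ae_timeGaussian] with q hq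
  have h0 : 0 < q.1 := hq.1
  have hs0 := Real.sqrt_pos.2 h0
  have hs1 : 0 ≤ 1 - Real.sqrt (1 - q.1) := by
    have : Real.sqrt (1 - q.1) ≤ 1 := Real.sqrt_le_one.2 (by linarith)
    linarith
  have hs2 : 1 - Real.sqrt (1 - q.1) ≤ Real.sqrt q.1 := by
    have h1 := Real.sq_sqrt h0.le
    have h2 := Real.sq_sqrt (sub_nonneg.2 hq.2.le)
    nlinarith [Real.sqrt_nonneg (1 - q.1)]
  have hpt : dist (ouPoint x q) q.2 ≤ Real.sqrt q.1 * (‖x‖ + ‖q.2‖) := by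
    have e : ouPoint x q - q.2 = Real.sqrt q.1 • x - (1 - Real.sqrt (1 - q.1)) • q.2 := by
      simp only [ouPoint]; module
    rw [dist_eq_norm, e]
    refine (norm_sub_le _ _).trans ?_
    rw [norm_smul, norm_smul, Real.norm_of_nonneg hs0.le, Real.norm_of_nonneg hs1, mul_add]
    gcongr
  have hlip : ‖h (ouPoint x q) - h q.2‖ ≤ C * (Real.sqrt q.1 * (‖x‖ + ‖q.2‖)) := by
    rw [← dist_eq_norm]
    exact (hC.dist_le_mul _ _).trans (by gcongr)
  rw [ouIntegrand, norm_mul, Real.norm_of_nonneg (by positivity), pow_zero, one_mul]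
  calc 1 / (2 * q.1) * ‖h (ouPoint x q) - h q.2‖
      ≤ 1 / (2 * q.1) * (C * (Real.sqrt q.1 * (‖x‖ + ‖q.2‖))) := by gcongr
    _ = Real.sqrt q.1 ^ (0 + 1) * (1 / (2 * q.1)) * (C * (‖x‖ + ‖q.2‖)) := by ring
    _ ≤ _ := mul_le_mul_of_nonneg_right (sqrt_pow_succ_div_le hq 0) (by positivity)

theorem pderivI_integral_ouIntegrand {d : ℕ} {g c : EuclideanSpace ℝ (Fin d) → ℝ}
    (hg : ContDiff ℝ (⊤ : ℕ∞) g) (hsupp : HasCompactSupport g) {k : ℕ}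
    (hint : ∀ x, Integrable (ouIntegrand g c k x) (timeGaussian d)) (j : Fin d) :
    pderivI j (fun x => ∫ q, ouIntegrand g c k x q ∂(timeGaussian d)) =
      fun x => ∫ q, ouIntegrand (pderivI j g) 0 (k + 1) x q ∂(timeGaussian d) := by
  ext x
  have hg' : Continuous (fderiv ℝ g) := hg.continuous_fderiv (by simp)
  obtain ⟨C, hC⟩ := hg'.bounded_above_of_compact_support (hsupp.fderiv ℝ)
  let F' : EuclideanSpace ℝ (Fin d) → ℝ × EuclideanSpace ℝ (Fin d) →
      (EuclideanSpace ℝ (Fin d) →L[ℝ] ℝ) := fun x q =>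
    (Real.sqrt q.1 ^ (k + 1) * (1 / (2 * q.1))) • fderiv ℝ g (ouPoint x q)
  have hmeas : AEStronglyMeasurable (F' x) (timeGaussian d) := by
    have hw : Measurable fun q : ℝ × EuclideanSpace ℝ (Fin d) =>
        Real.sqrt q.1 ^ (k + 1) * (1 / (2 * q.1)) := by fun_prop
    exact hw.aestronglyMeasurable.smul (hg'.comp (continuous_ouPoint x)).aestronglyMeasurable
  have hbound : ∀ᵐ q ∂(timeGaussian d), ∀ y ∈ (univ : Set (EuclideanSpace ℝ (Fin d))),
      ‖F' y q‖ ≤ 1 / 2 * q.1 ^ (-(1 / 2) : ℝ) * C := by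
    filter_upwards [ae_timeGaussian] with q hq y _
    have h0 : 0 < q.1 := hq.1
    rw [norm_smul, Real.norm_of_nonneg (by positivity)]
    exact mul_le_mul (sqrt_pow_succ_div_le hq k) (hC _) (norm_nonneg _) (by positivity)
  have hdom := integrable_timeGaussian_rpow_mul (d := d) (integrable_const C)
  have hd := hasFDerivAt_integral_of_dominated_of_fderiv_le (μ := timeGaussian d)
    (F := ouIntegrand g c k) (F' := F') (x₀ := x) (s := univ)
    (bound := fun q => 1 / 2 * q.1 ^ (-(1 / 2) : ℝ) * C) univ_mem
    (.of_forall fun y => (hint y).aestronglyMeasurable) (hint x) hmeas hbound hdom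
    (.of_forall fun q y _ => by
      have h1 : HasFDerivAt (fun y => ouPoint y q)
          (Real.sqrt q.1 • ContinuousLinearMap.id ℝ _) y :=
        ((hasFDerivAt_id y).const_smul (Real.sqrt q.1)).add_const (Real.sqrt (1 - q.1) • q.2)
      have h2 := (((hg.differentiable (by simp) (ouPoint y q)).hasFDerivAt.comp y h1).sub_const
        (c q.2)).const_mul (Real.sqrt q.1 ^ k * (1 / (2 * q.1)))
      refine h2.congr_fderiv ?_
      ext v
      simp [F']
      ring)
  have hF'int : Integrable (F' x) (timeGaussian d) :=
    hdom.mono' hmeas (hbound.mono fun q hq => hq x (mem_univ _))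
  rw [pderivI, hd.fderiv, ContinuousLinearMap.integral_apply hF'int]
  refine integral_congr_ae (.of_forall fun q => ?_)
  simp [F', ouIntegrand, pderivI]

theorem steinSol_eq_neg_integral_ouIntegrand {d : ℕ} {h : EuclideanSpace ℝ (Fin d) → ℝ}
    (hh : ContDiff ℝ (⊤ : ℕ∞) h) (hsupp : HasCompactSupport h) (x : EuclideanSpace ℝ (Fin d)) :
    steinSol d h x = -∫ q, ouIntegrand h h 0 x q ∂(timeGaussian d) := by
  rw [steinSol, timeGaussian, integral_prod _ (integrable_ouIntegrand_self hh hsupp x)]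
  congr 1
  refine setIntegral_congr_fun measurableSet_Ioo fun t ht => ?_
  have hs : Real.sqrt (1 - t) ≠ 0 := (Real.sqrt_pos.2 (by linarith [ht.2])).ne'
  have i1 : Integrable (fun z => h (Real.sqrt t • x + Real.sqrt (1 - t) • z)) (stdGaussian d) :=
    integrable_stdGaussian_of_continuous_hasCompactSupport
      (hh.continuous.comp (by fun_prop)) (hsupp.comp_add_smul _ hs)
  have i2 : Integrable h (stdGaussian d) :=
    integrable_stdGaussian_of_continuous_hasCompactSupport hh.continuous hsupp
  simp only [hbar, ouIntegrand, ouPoint, pow_zero, one_mul]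
  rw [integral_const_mul, integral_sub i1 (integrable_const _), integral_sub i1 i2]
  simp

theorem pderivList_steinSol {d : ℕ} {h : EuclideanSpace ℝ (Fin d) → ℝ}
    (hh : ContDiff ℝ (⊤ : ℕ∞) h) (hsupp : HasCompactSupport h) (j : Fin d) (l : List (Fin d)) :
    pderivList (j :: l) (steinSol d h) = fun x =>
      -∫ q, ouIntegrand (pderivList (j :: l) h) 0 (l.length + 1) x q ∂(timeGaussian d) := by
  induction l generalizing j with
  | nil =>
    have e : steinSol d h = fun x => -∫ q, ouIntegrand h h 0 x q ∂(timeGaussian d) :=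
      funext (steinSol_eq_neg_integral_ouIntegrand hh hsupp)
    ext x
    have key := congrFun (pderivI_integral_ouIntegrand hh hsupp
      (integrable_ouIntegrand_self hh hsupp) j) x
    simp only [pderivList, List.length_nil, zero_add, pderivI] at key ⊢
    rw [e, fderiv_fun_neg, neg_apply, key]
  | cons i l ih =>
    ext x
    have key := congrFun (pderivI_integral_ouIntegrand (hh.pderivList (i :: l))
      (hsupp.pderivList (i :: l)) (integrable_ouIntegrand_zero
        (hh.pderivList (i :: l)).continuous (hsupp.pderivList (i :: l))
          (Nat.succ_ne_zero l.length)) j) x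
    rw [pderivList, ih i, pderivI, fderiv_fun_neg, neg_apply]
    exact congrArg Neg.neg key

theorem abs_integral_le_log_add {F : ℝ → ℝ} (hF : IntervalIntegrable F volume 0 1)
    {A B β c : ℝ} (hβ : 0 < β) (hc : c ∈ Ico (0 : ℝ) 1)
    (h1 : ∀ t ∈ Ioo (0 : ℝ) 1, |F t| ≤ A * (1 - t)⁻¹)
    (h2 : ∀ t ∈ Ioo (0 : ℝ) 1, |F t| ≤ B * (1 - t) ^ (β - 1)) :
    |∫ t in 0..1, F t| ≤ A * -Real.log (1 - c) + B * ((1 - c) ^ β / β) := by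
  have hc1 : 0 < 1 - c := sub_pos.2 hc.2
  have i1 : IntervalIntegrable F volume 0 c :=
    hF.mono_set (by rw [uIcc_of_le hc.1, uIcc_of_le zero_le_one]; exact Icc_subset_Icc_right hc.2.le)
  have i2 : IntervalIntegrable F volume c 1 :=
    hF.mono_set (by
      rw [uIcc_of_le hc.2.le, uIcc_of_le zero_le_one]; exact Icc_subset_Icc_left hc.1)
  have b1 : |∫ t in 0..c, F t| ≤ ∫ t in 0..c, A * (1 - t)⁻¹ := by
    rw [← Real.norm_eq_abs]
    refine intervalIntegral.norm_integral_le_of_norm_le hc.1 (.of_forall fun t ht =>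
      h1 t ⟨ht.1, ht.2.trans_lt hc.2⟩) (ContinuousOn.intervalIntegrable ?_)
    refine continuousOn_const.mul (ContinuousOn.inv₀ (by fun_prop) fun t ht => ?_)
    rw [uIcc_of_le hc.1] at ht
    linarith [ht.2]
  have ipow : IntervalIntegrable (fun t : ℝ => (1 - t) ^ (β - 1)) volume c 1 := by
    have := (intervalIntegral.intervalIntegrable_rpow' (a := 1 - c) (b := 0) (r := β - 1)
      (by linarith)).comp_sub_left 1
    simpa using this
  have b2 : |∫ t in c..1, F t| ≤ ∫ t in c..1, B * (1 - t) ^ (β - 1) := by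
    rw [← Real.norm_eq_abs]
    refine intervalIntegral.norm_integral_le_of_norm_le hc.2.le ?_ (ipow.const_mul B)
    have hne : ∀ᵐ t : ℝ, t ≠ 1 := Measure.ae_ne volume 1
    filter_upwards [hne] with t ht ht'
    exact h2 t ⟨hc.1.trans_lt ht'.1, lt_of_le_of_ne ht'.2 ht⟩
  have e1 : ∫ t in 0..c, A * (1 - t)⁻¹ = A * -Real.log (1 - c) := by
    rw [intervalIntegral.integral_const_mul,
      intervalIntegral.integral_comp_sub_left (fun u : ℝ => u⁻¹), sub_zero,
      integral_inv_of_pos hc1 one_pos, one_div, Real.log_inv]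
  have e2 : ∫ t in c..1, B * (1 - t) ^ (β - 1) = B * ((1 - c) ^ β / β) := by
    rw [intervalIntegral.integral_const_mul,
      intervalIntegral.integral_comp_sub_left (fun u : ℝ => u ^ (β - 1)), sub_self,
      integral_rpow (Or.inl (by linarith)), sub_add_cancel, Real.zero_rpow hβ.ne', sub_zero]
  rw [← intervalIntegral.integral_add_adjacent_intervals i1 i2, ← e1, ← e2]
  exact (abs_add_le _ _).trans (add_le_add b1 b2)

theorem abs_integral_ouIntegrand_sub_le {d : ℕ} (hd : 1 ≤ d) {α L : ℝ} (hα : 0 < α) (hL0 : 0 ≤ L)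
    {g : EuclideanSpace ℝ (Fin d) → ℝ} (hg : ContDiff ℝ (⊤ : ℕ∞) g) (hsupp : HasCompactSupport g)
    (hL : ∀ x y, |g x - g y| ≤ L * dist x y ^ α) (i j : Fin d) (p : ℕ)
    (x y : EuclideanSpace ℝ (Fin d)) {c : ℝ} (hc : c ∈ Ico (0 : ℝ) 1) :
    |∫ q, ouIntegrand (pderivI i (pderivI j g)) 0 (p + 2) x q ∂(timeGaussian d) -
        ∫ q, ouIntegrand (pderivI i (pderivI j g)) 0 (p + 2) y q ∂(timeGaussian d)| ≤
      L * dist x y ^ α * -Real.log (1 - c) +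
        L * (2 ^ (α / 2) * (α + d + 1) * Real.Gamma ((α + d) / 2) / Real.Gamma (d / 2)) *
          ((1 - c) ^ (α / 2) / (α / 2)) := by
  have hint := integrable_ouIntegrand_zero ((hg.pderivI j).pderivI i).continuous
    ((hsupp.pderivI j).pderivI i) (Nat.succ_ne_zero (p + 1))
  let G : ℝ → EuclideanSpace ℝ (Fin d) → ℝ := fun t a =>
    ∫ z, pderivI i (pderivI j g) (Real.sqrt t • a + Real.sqrt (1 - t) • z) ∂(stdGaussian d)
  let w : ℝ → ℝ := fun t => Real.sqrt t ^ (p + 2) * (1 / (2 * t))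
  have hfib : ∀ a t, ∫ z, ouIntegrand (pderivI i (pderivI j g)) 0 (p + 2) a (t, z)
      ∂(stdGaussian d) = w t * G t a := by
    intro a t
    simp only [ouIntegrand, ouPoint, Pi.zero_apply, sub_zero]
    exact integral_const_mul _ _
  have hi : ∀ a, IntegrableOn (fun t => w t * G t a) (Ioo 0 1) := by
    intro a
    have := (hint a).integral_prod_left
    simp only [hfib] at this
    exact this
  have hval : ∀ a, ∫ q, ouIntegrand (pderivI i (pderivI j g)) 0 (p + 2) a q ∂(timeGaussian d) =
      ∫ t in Ioo (0 : ℝ) 1, w t * G t a := by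
    intro a
    have := integral_prod _ (hint a)
    simp only [hfib] at this
    exact this
  have hw : ∀ t ∈ Ioo (0 : ℝ) 1, 0 ≤ w t ∧ w t ≤ 1 / 2 := by
    intro t ht
    have h0 : 0 < t := ht.1
    have e : w t = 1 / 2 * Real.sqrt t ^ p := by
      simp only [w]
      rw [pow_add, Real.sq_sqrt h0.le]
      field_simp
    rw [e]
    have : Real.sqrt t ^ p ≤ 1 := pow_le_one₀ (Real.sqrt_nonneg t) (Real.sqrt_le_one.2 ht.2.le)
    exact ⟨by positivity, by linarith⟩
  rw [hval, hval, ← integral_sub (hi x) (hi y), ← integral_Ioc_eq_integral_Ioo,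
    ← intervalIntegral.integral_of_le zero_le_one]
  refine abs_integral_le_log_add ?_ (by positivity) hc (fun t ht => ?_) (fun t ht => ?_)
  · rw [intervalIntegrable_iff_integrableOn_Ioo_of_le zero_le_one]
    exact (hi x).sub (hi y)
  · have ht1 : 0 < 1 - t := sub_pos.2 ht.2
    have key := sq_mul_abs_integral_pderivI_sub_le hg hsupp hL0 hL i j (Real.sqrt t • x)
      (Real.sqrt t • y) (Real.sqrt_pos.2 ht1)
    rw [Real.sq_sqrt ht1.le] at key
    have hdist : dist (Real.sqrt t • x) (Real.sqrt t • y) ^ α ≤ dist x y ^ α := by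
      refine Real.rpow_le_rpow dist_nonneg ?_ hα.le
      rw [dist_smul₀, Real.norm_of_nonneg (Real.sqrt_nonneg t)]
      exact mul_le_of_le_one_left dist_nonneg (Real.sqrt_le_one.2 ht.2.le)
    rw [← mul_sub, abs_mul, abs_of_nonneg (hw t ht).1, ← div_eq_mul_inv, le_div_iff₀ ht1]
    calc w t * |G t x - G t y| * (1 - t) = w t * ((1 - t) * |G t x - G t y|) := by ring
      _ ≤ 1 / 2 * (2 * L * dist x y ^ α) := by
        refine mul_le_mul (hw t ht).2 (key.trans ?_) (by positivity) (by norm_num)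
        gcongr
      _ = L * dist x y ^ α := by ring
  · have ht1 : 0 < 1 - t := sub_pos.2 ht.2
    have key := fun a => sq_mul_abs_integral_pderivI_le hd hg hsupp hα hL i j (Real.sqrt t • a)
      (Real.sqrt_pos.2 ht1)
    rw [Real.sq_sqrt ht1.le, integral_norm_rpow_mul_stdGaussian hd hα] at key
    have hpow : Real.sqrt (1 - t) ^ α = (1 - t) ^ (α / 2) := by
      rw [Real.sqrt_eq_rpow, ← Real.rpow_mul ht1.le, one_div_mul_eq_div]
    rw [hpow] at key
    set K := 2 ^ (α / 2) * (α + d + 1) * Real.Gamma ((α + d) / 2) / Real.Gamma (d / 2)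
    rw [← mul_sub, abs_mul, abs_of_nonneg (hw t ht).1, Real.rpow_sub_one ht1.ne', ← mul_div_assoc,
      le_div_iff₀ ht1]
    calc w t * |G t x - G t y| * (1 - t)
        ≤ 1 / 2 * |G t x - G t y| * (1 - t) := by
          gcongr
          exact (hw t ht).2
      _ ≤ 1 / 2 * (|G t x| + |G t y|) * (1 - t) := by
          gcongr
          exact abs_sub _ _
      _ = 1 / 2 * ((1 - t) * |G t x| + (1 - t) * |G t y|) := by ring
      _ ≤ 1 / 2 * (L * (1 - t) ^ (α / 2) * K + L * (1 - t) ^ (α / 2) * K) := by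
          exact mul_le_mul_of_nonneg_left (add_le_add (key x) (key y)) (by norm_num)
      _ = L * K * (1 - t) ^ (α / 2) := by ring

/-- **Proposition 4.1, first part**: log-Hölder regularity of the derivatives of order `p + 2`
of Barbour's solution, when all derivatives of order `p` of `h` are `α`-Hölder with common
constant `L`. -/
theorem steinSol_higher_deriv_log_regularity
    {d : ℕ} (hd : 1 ≤ d) {α : ℝ} (hα : α ∈ Set.Ioc (0 : ℝ) 1) (p : ℕ)
    (h : EuclideanSpace ℝ (Fin d) → ℝ)
    (hsmooth : ContDiff ℝ (⊤ : ℕ∞) h) (hsupp : HasCompactSupport h)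
    {L : ℝ} (hL0 : 0 ≤ L)
    (hL : ∀ ι : Fin p → Fin d, ∀ x y,
      |pderivList (List.ofFn ι) h x - pderivList (List.ofFn ι) h y| ≤ L * dist x y ^ α) :
    ∀ ι : Fin (p + 2) → Fin d, ∀ x y : EuclideanSpace ℝ (Fin d),
      (dist x y ≤ 1 →
        |pderivList (List.ofFn ι) (steinSol d h) x -
            pderivList (List.ofFn ι) (steinSol d h) y| ≤
          L * dist x y ^ α *
            (2 ^ (α / 2 + 1) * ((α + d + 1) / α) * Real.Gamma ((α + d) / 2) /
                Real.Gamma (d / 2) - 2 * Real.log (dist x y))) ∧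
      (1 < dist x y →
        |pderivList (List.ofFn ι) (steinSol d h) x -
            pderivList (List.ofFn ι) (steinSol d h) y| ≤
          2 ^ (α / 2 + 1) * ((α + d + 1) / α) * Real.Gamma ((α + d) / 2) /
              Real.Gamma (d / 2) * L) := by
  intro ι x y
  have hsub : ∀ c ∈ Ico (0 : ℝ) 1, |pderivList (List.ofFn ι) (steinSol d h) x -
      pderivList (List.ofFn ι) (steinSol d h) y| ≤
      L * dist x y ^ α * -Real.log (1 - c) +
        L * (2 ^ (α / 2) * (α + d + 1) * Real.Gamma ((α + d) / 2) / Real.Gamma (d / 2)) *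
          ((1 - c) ^ (α / 2) / (α / 2)) := by
    intro c hc
    rw [List.ofFn_succ, List.ofFn_succ, pderivList_steinSol hsmooth hsupp, neg_sub_neg, abs_sub_comm]
    simp only [List.length_cons, List.length_ofFn]
    exact abs_integral_ouIntegrand_sub_le hd hα.1 hL0 (hsmooth.pderivList _) (hsupp.pderivList _)
      (hL fun k => ι k.succ.succ) (ι 0) (ι (Fin.succ 0)) p x y hc
  have hα0 : α ≠ 0 := hα.1.ne'
  have hpow : (2 : ℝ) ^ (α / 2 + 1) = 2 ^ (α / 2) * 2 := Real.rpow_add_one two_ne_zero _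
  refine ⟨fun hle => ?_, fun _ => ?_⟩
  · rcases dist_nonneg.eq_or_lt (a := 0) (b := dist x y) with h0 | hpos
    · rw [dist_eq_zero.1 h0.symm]
      simp [hα0]
    · have hsq : 1 - (1 - dist x y ^ 2) = dist x y ^ 2 := by ring
      have hr : (dist x y ^ 2) ^ (α / 2) = dist x y ^ α := by
        rw [← Real.rpow_two, ← Real.rpow_mul hpos.le]
        ring_nf
      refine (hsub (1 - dist x y ^ 2) ⟨?_, ?_⟩).trans_eq ?_
      · have := pow_le_one₀ (n := 2) hpos.le hle
        linarith
      · have := pow_pos hpos 2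
        linarith
      · rw [hsq, hr, Real.log_pow, hpow]
        push_cast
        field_simp
        ring
  · refine (hsub 0 ⟨le_rfl, one_pos⟩).trans_eq ?_
    rw [sub_zero, Real.log_one, Real.one_rpow, hpow]
    field_simp
    ring
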